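/- Let x_1,…,x_L be real numbers, η_1,…,η_L i.i.d. Laplace(b), c_k the k-th largest of the x_i, and let a be the set of k indices with the largest noisy values x_i + η_i. If b ≤ α/(2(ln L + ln(k/β))), then for any fixed index i with x_i > c_k + α, the probability that i ∉ a is at most β/L. -/

import Mathlib

open MeasureTheory

/-- The Laplace distribution with scale `b`. -/
noncomputable def laplace (b : ℝ) : Measure ℝ :=
  volume.withDensity fun z => ENNReal.ofReal ((1 / (2 * b)) * Real.exp (-|z| / b))

lemma lint_Ioi (b c A : ℝ) (hb : 0 < b) (hA : 0 ≤ A) :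
    ∫⁻ z in Set.Ioi c, ENNReal.ofReal (A * Real.exp (-z / b))
      = ENNReal.ofReal (A * (b * Real.exp (-c / b))) := by
  have ha : -(1 / b) < 0 := by
    have : 0 < 1 / b := by positivity
    linarith
  have h1 := integrableOn_exp_mul_Ioi ha c
  have h2 := integral_exp_mul_Ioi ha c
  have e : ∀ z : ℝ, -z / b = -(1 / b) * z := fun z => by ring
  simp only [fun z : ℝ => e z]
  rw [← ofReal_integral_eq_lintegral_ofReal (h1.const_mul A)
    (Filter.Eventually.of_forall fun z => by positivity), integral_const_mul, h2]
  congr 1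
  field_simp

lemma lint_Iic (b c A : ℝ) (hb : 0 < b) (hA : 0 ≤ A) :
    ∫⁻ z in Set.Iic c, ENNReal.ofReal (A * Real.exp (z / b))
      = ENNReal.ofReal (A * (b * Real.exp (c / b))) := by
  have ha : 0 < 1 / b := by positivity
  have h1 := integrableOn_exp_mul_Iic ha c
  have h2 := integral_exp_mul_Iic ha c
  have e : ∀ z : ℝ, z / b = b⁻¹ * z := fun z => by ring
  rw [one_div] at h1 h2
  simp only [e]
  rw [← ofReal_integral_eq_lintegral_ofReal (h1.const_mul A)
    (Filter.Eventually.of_forall fun z => by positivity), integral_const_mul, h2]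
  congr 1
  field_simp

lemma laplace_prob (b : ℝ) (hb : 0 < b) : IsProbabilityMeasure (laplace b) := by
  constructor
  have hu : (Set.univ : Set ℝ) = Set.Iic 0 ∪ Set.Ioi 0 := by simp
  rw [hu, measure_union (Set.Iic_disjoint_Ioi le_rfl) measurableSet_Ioi, laplace,
    withDensity_apply _ measurableSet_Iic, withDensity_apply _ measurableSet_Ioi]
  have h1 : ∫⁻ z in Set.Iic (0:ℝ), ENNReal.ofReal ((1 / (2 * b)) * Real.exp (-|z| / b))
      = ENNReal.ofReal (1 / 2) := by
    rw [setLIntegral_congr_fun (g := fun z => ENNReal.ofReal ((1 / (2 * b)) * Real.exp (z / b)))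
      measurableSet_Iic, lint_Iic b 0 _ hb (by positivity)]
    · congr 1
      simp
      field_simp
    · intro z hz
      simp only [Set.mem_Iic] at hz
      simp [abs_of_nonpos hz]
  have h2 : ∫⁻ z in Set.Ioi (0:ℝ), ENNReal.ofReal ((1 / (2 * b)) * Real.exp (-|z| / b))
      = ENNReal.ofReal (1 / 2) := by
    rw [setLIntegral_congr_fun (g := fun z => ENNReal.ofReal ((1 / (2 * b)) * Real.exp (-z / b)))
      measurableSet_Ioi, lint_Ioi b 0 _ hb (by positivity)]
    · congr 1
      simp
      field_simp
    · intro z hz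
      simp only [Set.mem_Ioi] at hz
      simp [abs_of_pos hz]
  rw [h1, h2, ← ENNReal.ofReal_add (by norm_num) (by norm_num)]
  norm_num

lemma laplace_upper (b t : ℝ) (hb : 0 < b) :
    laplace b (Set.Ici t) ≤ ENNReal.ofReal (1 / 2 * Real.exp (-t / b)) := by
  rw [laplace, withDensity_apply _ measurableSet_Ici, setLIntegral_congr Ioi_ae_eq_Ici.symm]
  calc _ ≤ ∫⁻ z in Set.Ioi t, ENNReal.ofReal ((1 / (2 * b)) * Real.exp (-z / b)) := by
        apply lintegral_mono
        intro z
        apply ENNReal.ofReal_le_ofReal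
        have := le_abs_self z
        gcongr
    _ = _ := by
        rw [lint_Ioi b t _ hb (by positivity)]
        congr 1
        field_simp

lemma laplace_lower (b t : ℝ) (hb : 0 < b) :
    laplace b (Set.Iic t) ≤ ENNReal.ofReal (1 / 2 * Real.exp (t / b)) := by
  rw [laplace, withDensity_apply _ measurableSet_Iic]
  calc _ ≤ ∫⁻ z in Set.Iic t, ENNReal.ofReal ((1 / (2 * b)) * Real.exp (z / b)) := by
        apply lintegral_mono
        intro z
        apply ENNReal.ofReal_le_ofReal
        have := neg_abs_le z
        gcongr
    _ = _ := by
        rw [lint_Iic b t _ hb (by positivity)]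
        congr 1
        field_simp

lemma laplace_pair (b α c : ℝ) (hb : 0 < b) :
    ∫⁻ y in Set.Ioi c, (laplace b (Set.Ici (α + y)) * laplace b (Set.Ici (α + y))) ∂(laplace b)
      ≤ ENNReal.ofReal (1 / 8 * Real.exp (-2 * α / b) * Real.exp (-c / b)) := by
  calc _ ≤ ∫⁻ y in Set.Ioi c, ENNReal.ofReal (1 / 4 * Real.exp (-2 * (α + y) / b)) ∂(laplace b) := by
        apply lintegral_mono
        intro y
        refine (mul_le_mul' (laplace_upper b _ hb) (laplace_upper b _ hb)).trans ?_
        rw [← ENNReal.ofReal_mul (by positivity)]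
        apply ENNReal.ofReal_le_ofReal
        apply le_of_eq
        rw [show -2 * (α + y) / b = -(α + y) / b + -(α + y) / b by ring, Real.exp_add]
        ring
    _ = ∫⁻ y in Set.Ioi c, ENNReal.ofReal ((1 / (2 * b)) * Real.exp (-|y| / b)) *
          ENNReal.ofReal (1 / 4 * Real.exp (-2 * (α + y) / b)) := by
        rw [laplace, setLIntegral_withDensity_eq_setLIntegral_mul _ (by fun_prop) (by fun_prop)
          measurableSet_Ioi]
        rfl
    _ ≤ ∫⁻ y in Set.Ioi c,
          ENNReal.ofReal ((1 / (8 * b) * Real.exp (-2 * α / b)) * Real.exp (-y / b)) := by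
        apply lintegral_mono
        intro y
        dsimp only
        rw [← ENNReal.ofReal_mul (by positivity)]
        apply ENNReal.ofReal_le_ofReal
        calc _ ≤ (1 / (2 * b)) * Real.exp (y / b) * (1 / 4 * Real.exp (-2 * (α + y) / b)) := by
              have := neg_abs_le y
              gcongr
          _ = _ := by
              rw [show -2 * (α + y) / b = -2 * α / b + -y / b + -(y / b) by ring, Real.exp_add,
                Real.exp_add, Real.exp_neg (y / b)]
              field_simp
              norm_num
    _ = _ := by
        rw [lint_Ioi b c _ hb (by positivity)]
        congr 1
        field_simp

lemma pi_triple {L : ℕ} (b α c : ℝ) (hb : 0 < b) (i j l : Fin L) (hij : j ≠ i) (hil : l ≠ i)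
    (hjl : j ≠ l) :
    (Measure.pi fun _ : Fin L => laplace b)
        {ω | c < ω i ∧ α + ω i ≤ ω j ∧ α + ω i ≤ ω l}
      ≤ ENNReal.ofReal (1 / 8 * Real.exp (-2 * α / b) * Real.exp (-c / b)) := by
  have := laplace_prob b hb
  set P := Measure.pi fun _ : Fin L => laplace b with hP
  have hind : ProbabilityTheory.iIndepFun (fun (m : Fin L) (ω : Fin L → ℝ) => ω m) P :=
    ProbabilityTheory.iIndepFun_pi (X := fun (_ : Fin L) (z : ℝ) => z)
      (fun _ => aemeasurable_id)
  have hm : ∀ m : Fin L, Measurable (fun ω : Fin L → ℝ => ω m) := fun m => measurable_pi_apply m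
  have hmap : ∀ m : Fin L, P.map (fun ω : Fin L → ℝ => ω m) = laplace b := fun m =>
    (measurePreserving_eval (fun _ : Fin L => laplace b) m).map_eq
  have h1 := (ProbabilityTheory.indepFun_iff_map_prod_eq_prod_map_map
    (hm j).aemeasurable (hm l).aemeasurable).1 (hind.indepFun hjl)
  have h2 := (ProbabilityTheory.indepFun_iff_map_prod_eq_prod_map_map
    (hm i).aemeasurable ((hm j).prodMk (hm l)).aemeasurable).1
    (hind.indepFun_prodMk hm j l i hij hil).symm
  rw [h1, hmap, hmap, hmap] at h2
  set S : Set (ℝ × ℝ × ℝ) := {p | c < p.1 ∧ α + p.1 ≤ p.2.1 ∧ α + p.1 ≤ p.2.2} with hS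
  have hSm : MeasurableSet S := by
    have m1 : MeasurableSet {p : ℝ × ℝ × ℝ | c < p.1} :=
      measurableSet_lt (by fun_prop) (by fun_prop)
    have m2 : MeasurableSet {p : ℝ × ℝ × ℝ | α + p.1 ≤ p.2.1} :=
      measurableSet_le (by fun_prop) (by fun_prop)
    have m3 : MeasurableSet {p : ℝ × ℝ × ℝ | α + p.1 ≤ p.2.2} :=
      measurableSet_le (by fun_prop) (by fun_prop)
    exact m1.inter (m2.inter m3)
  have h3 : P {ω | c < ω i ∧ α + ω i ≤ ω j ∧ α + ω i ≤ ω l}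
      = ((laplace b).prod ((laplace b).prod (laplace b))) S := by
    rw [← h2, Measure.map_apply ((hm i).prodMk ((hm j).prodMk (hm l))) hSm]
    rfl
  rw [h3, Measure.prod_apply hSm]
  refine le_trans (le_of_eq ?_) (laplace_pair b α c hb)
  rw [← lintegral_indicator measurableSet_Ioi]
  congr 1
  ext y
  by_cases hy : c < y
  · rw [Set.indicator_of_mem (by simpa using hy), ← Measure.prod_prod]
    congr 1
    ext p
    simp [hS, hy, Prod.le_def]
  · rw [Set.indicator_of_notMem (by simpa using hy)]
    have he : Set.preimage (Prod.mk y) S = ∅ := by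
      ext p
      simp [hS, hy]
    rw [he, measure_empty]

/-- In noisy top-k selection with i.i.d. Laplace(b) noise,
`b ≤ α / (2(ln L + ln(k/β)))`, a fixed index whose true count exceeds
`c_k + α` is omitted with probability at most `β/L`. -/
theorem noisy_topk_large_count_omitted (L k : ℕ) (hk : 1 ≤ k) (hkL : k ≤ L)
    (x : Fin L → ℝ) (α β b : ℝ) (hα : 0 < α) (hβ0 : 0 < β) (hβ1 : β < 1)
    (hb : 0 < b) (hble : b ≤ α / (2 * (Real.log L + Real.log (k / β))))
    (ck : ℝ)
    (hck1 : k ≤ (Finset.univ.filter fun i => ck ≤ x i).card)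
    (hck2 : L - k + 1 ≤ (Finset.univ.filter fun i => x i ≤ ck).card)
    (sel : (Fin L → ℝ) → Finset (Fin L))
    (hselcard : ∀ y, (sel y).card = k)
    (hseltop : ∀ y, ∀ i ∈ sel y, ∀ j, j ∉ sel y → y j ≤ y i)
    (i : Fin L) (hi : ck + α < x i) :
    (Measure.pi fun _ : Fin L => laplace b)
        {ω | i ∉ sel fun j => x j + ω j} ≤ ENNReal.ofReal (β / L) := by
  classical
  have := laplace_prob b hb
  have hL : 1 ≤ L := hk.trans hkL
  have hLr : (1:ℝ) ≤ L := by exact_mod_cast hL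
  have hkr : (1:ℝ) ≤ k := by exact_mod_cast hk
  set P := Measure.pi fun _ : Fin L => laplace b with hP
  set c : ℝ := b * Real.log L - α with hc
  set T : Fin L × Fin L → Set (Fin L → ℝ) := fun p =>
    if p.1 ≠ i ∧ p.2 ≠ i ∧ p.1 ≠ p.2 then
      {ω | c < ω i ∧ α + ω i ≤ ω p.1 ∧ α + ω i ≤ ω p.2} else ∅ with hT
  have hA : (Finset.univ.filter fun j => ck < x j).card + 1 ≤ k := by
    have h := Finset.card_filter_add_card_filter_not (s := (Finset.univ : Finset (Fin L)))
      (fun j => x j ≤ ck)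
    simp only [not_le, Finset.card_univ, Fintype.card_fin] at h
    omega
  have hsub : {ω : Fin L → ℝ | i ∉ sel fun j => x j + ω j} ⊆
      {ω | ω i ∈ Set.Iic c} ∪ ⋃ p : Fin L × Fin L, T p := by
    intro ω hω
    simp only [Set.mem_ofPred_eq] at hω
    by_cases hci : ω i ≤ c
    · left; exact hci
    right
    push Not at hci
    set s := sel fun j => x j + ω j with hs
    set A := Finset.univ.filter fun j => ck < x j with hAdef
    have hiA : i ∈ A := by simp [hAdef]; linarith
    have h1 : s ∩ A ⊆ A.erase i := by
      intro j hj
      rw [Finset.mem_inter] at hj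
      rw [Finset.mem_erase]
      exact ⟨fun h => hω (h ▸ hj.1), hj.2⟩
    have h2 := Finset.card_le_card h1
    rw [Finset.card_erase_of_mem hiA] at h2
    have h3 := Finset.card_inter_add_card_sdiff s A
    have h4 : s.card = k := hselcard _
    have h5 : 0 < A.card := Finset.card_pos.2 ⟨i, hiA⟩
    have h6 : 1 < (s \ A).card := by omega
    obtain ⟨j, hj, l, hl, hjl⟩ := Finset.one_lt_card.1 h6
    have key : ∀ j ∈ s \ A, j ≠ i ∧ α + ω i ≤ ω j := by
      intro j hj
      rw [Finset.mem_sdiff] at hj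
      refine ⟨fun h => hω (h ▸ hj.1), ?_⟩
      have h7 : x i + ω i ≤ x j + ω j := hseltop _ j hj.1 i hω
      have h8 : x j ≤ ck := by
        have := hj.2
        simpa [hAdef] using this
      linarith
    rw [Set.mem_iUnion]
    refine ⟨(j, l), ?_⟩
    have hcond : j ≠ i ∧ l ≠ i ∧ j ≠ l := ⟨(key j hj).1, (key l hl).1, hjl⟩
    simp only [hT]
    rw [if_pos hcond]
    exact ⟨hci, (key j hj).2, (key l hl).2⟩
  set E : ℝ := Real.exp (-α / b) with hE
  have hexpL : Real.exp (b * Real.log L / b) = L := by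
    rw [mul_div_cancel_left₀ _ hb.ne', Real.exp_log (by linarith)]
  have hfirst : P {ω | ω i ∈ Set.Iic c} ≤ ENNReal.ofReal (1 / 2 * (L * E)) := by
    have := (measurePreserving_eval (fun _ : Fin L => laplace b) i).measure_preimage
      (measurableSet_Iic (a := c)).nullMeasurableSet
    refine (le_of_eq this).trans ((laplace_lower b c hb).trans (le_of_eq ?_))
    congr 2
    rw [hc, show (b * Real.log L - α) / b = b * Real.log L / b + -α / b by ring, Real.exp_add, hexpL]
  have hpair : ∀ p, P (T p) ≤ ENNReal.ofReal (1 / 8 * (E / L)) := by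
    intro p
    simp only [hT]
    split_ifs with h
    · refine (pi_triple b α c hb i p.1 p.2 h.1 h.2.1 h.2.2).trans (le_of_eq ?_)
      congr 1
      rw [hc, mul_assoc, ← Real.exp_add,
        show -2 * α / b + -(b * Real.log L - α) / b = -α / b - b * Real.log L / b by ring,
        Real.exp_sub, hexpL]
    · simp
  have hD : 0 < Real.log L + Real.log (k / β) := by
    have h1 : 0 ≤ Real.log L := Real.log_nonneg hLr
    have h2 : 0 < Real.log (k / β) := by
      apply Real.log_pos
      rw [lt_div_iff₀ hβ0]
      linarith
    linarith
  have hEle : E ≤ (β / (L * k)) ^ 2 := by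
    have h1 : b * (2 * (Real.log L + Real.log (k / β))) ≤ α :=
      (le_div_iff₀ (by positivity)).1 hble
    have h2 : -α / b ≤ -(2 * (Real.log L + Real.log (k / β))) := by
      rw [div_le_iff₀ hb]; linarith
    refine (Real.exp_le_exp.2 h2).trans (le_of_eq ?_)
    rw [← Real.log_mul (by positivity) (by positivity), Real.exp_neg, two_mul, Real.exp_add,
      Real.exp_log (by positivity)]
    field_simp
  have hE0 : 0 < E := Real.exp_pos _
  calc P {ω | i ∉ sel fun j => x j + ω j}
      ≤ P {ω | ω i ∈ Set.Iic c} + ∑ p : Fin L × Fin L, P (T p) := by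
        refine (measure_mono hsub).trans ((measure_union_le _ _).trans ?_)
        gcongr
        exact measure_iUnion_fintype_le _ _
    _ ≤ ENNReal.ofReal (1 / 2 * (L * E)) +
          ∑ p : Fin L × Fin L, ENNReal.ofReal (1 / 8 * (E / L)) := by
        gcongr
        exact hpair _
    _ = ENNReal.ofReal (1 / 2 * (L * E) + L * L * (1 / 8 * (E / L))) := by
        rw [← ENNReal.ofReal_sum_of_nonneg (fun _ _ => by positivity),
          ← ENNReal.ofReal_add (by positivity) (Finset.sum_nonneg fun _ _ => by positivity)]
        simp
    _ ≤ ENNReal.ofReal (β / L) := by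
        apply ENNReal.ofReal_le_ofReal
        have hLne : (L:ℝ) ≠ 0 := by positivity
        have e1 : 1 / 2 * (L * E) + L * L * (1 / 8 * (E / L)) = 5 / 8 * (L * E) := by
          field_simp; ring
        rw [e1]
        have e2 : (L:ℝ) * E ≤ β / L := by
          calc (L:ℝ) * E ≤ L * (β / (L * k)) ^ 2 := by gcongr
            _ = (β / L) * (β / k ^ 2) := by field_simp
            _ ≤ (β / L) * 1 := by
                gcongr
                rw [div_le_one (by positivity)]
                nlinarith
            _ = β / L := mul_one _
        have : 0 < L * E := by positivity
        linarith
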